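/- Let k ≥ 4 and let w be a word over Σ = {a,b}. Let p, q ∈ {u, v} be two consecutive occurrences in w, at positions s < t respectively, that do not overlap (t ≥ s + k), so that w contains the factor p x q where x is the word of length t − s − k between them. Let F_p and F_q be the sets of forbidden positions of these occurrences. Then F_p ⊆ { (j + |x|) mod k : j ∈ F_q } ∪ {0}. -/

import Mathlib

namespace Restivo

/-- Words over the two-letter alphabet Σ = {a, b}, encoded as lists of booleans. -/
abbrev Word := List Bool

/-- The letter `a`. -/
def a : Bool := false

/-- The letter `b`. -/
def b : Bool := true

/-- Kleene star: all finite concatenations of words from `S` (including the empty word). -/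
def kstar (S : Set Word) : Set Word :=
  { w | ∃ L : List Word, (∀ x ∈ L, x ∈ S) ∧ L.flatten = w }

/-- Prefixes of words of `L`. -/
def Pref (L : Set Word) : Set Word := { w | ∃ z : Word, w ++ z ∈ L }

/-- Factors (contiguous subwords) of words of `L`. -/
def Facts (L : Set Word) : Set Word := { w | ∃ x y : Word, x ++ w ++ y ∈ L }

/-- The word u = b a^(k-1). -/
def u (k : ℕ) : Word := b :: List.replicate (k - 1) a

/-- The word v = b^(k-1) a. -/
def v (k : ℕ) : Word := List.replicate (k - 1) b ++ [a]

/-- The set S_k = (Σ^k \ {u, v}) ∪ (Σ^(k-1) \ {a^(k-1), b^(k-1)}). -/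
def Sk (k : ℕ) : Set Word :=
  { w | w.length = k ∧ w ≠ u k ∧ w ≠ v k } ∪
  { w | w.length = k - 1 ∧ w ≠ List.replicate (k - 1) a ∧ w ≠ List.replicate (k - 1) b }

/-- Position `j` is forbidden in `w` w.r.t. `S` if the suffix of `w` starting from
position `j` is not a prefix of any word of `S*`. -/
def Forbidden (S : Set Word) (w : Word) (j : ℕ) : Prop :=
  w.drop j ∉ Pref (kstar S)

/-- The word `p` occurs in `w` at position `s`. -/
def OccursAt (p w : Word) (s : ℕ) : Prop :=
  s + p.length ≤ w.length ∧ (w.drop s).take p.length = p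

/-- The set of (locally enumerated) forbidden positions of the occurrence of `p`
at position `s` in `w`, with respect to `S_k`. -/
def Focc (k : ℕ) (w p : Word) (s : ℕ) : Set ℕ :=
  { i | i < p.length ∧ Forbidden (Sk k) w (s + i) }

/-- Two occurrences (of words from {u, v}) at positions `s < t` in `w` are
consecutive: no word from {u, v} occurs at a position strictly between them. -/
def Consecutive (k : ℕ) (w : Word) (s t : ℕ) : Prop :=
  s < t ∧ ∀ m, s < m → m < t → ¬ OccursAt (u k) w m ∧ ¬ OccursAt (v k) w m

/-- `w` is a minimal uncompletable word for `S`. -/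
def MinUncompletable (S : Set Word) (w : Word) : Prop :=
  w ∉ Facts (kstar S) ∧ ∀ w' : Word, w' ∉ Facts (kstar S) → w.length ≤ w'.length

theorem length_u {k : ℕ} (hk : 1 ≤ k) : (u k).length = k := by
  simp only [u, List.length_cons, List.length_replicate]
  omega

theorem length_v {k : ℕ} (hk : 1 ≤ k) : (v k).length = k := by
  simp only [v, List.length_append, List.length_replicate, List.length_singleton]
  omega

/-- Prepending a word of `S` to a prefix of a word of `S*` gives a prefix of a word of `S*`. -/
theorem append_mem_Pref_kstar {S : Set Word} {x y : Word} (hx : x ∈ S)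
    (hy : y ∈ Pref (kstar S)) : x ++ y ∈ Pref (kstar S) := by
  obtain ⟨z, L, hL, hz⟩ := hy
  refine ⟨z, x :: L, ?_, by simp [hz]⟩
  rintro y (_ | ⟨_, hy⟩)
  exacts [hx, hL _ hy]

/-- A forbidden position that starts neither `u` nor `v` propagates `k` letters to the right. -/
theorem Forbidden.add_of_not_occursAt {k : ℕ} (hk : 1 ≤ k) {w : Word} {m : ℕ}
    (h : Forbidden (Sk k) w m) (hm : m + k ≤ w.length)
    (hu : ¬ OccursAt (u k) w m) (hv : ¬ OccursAt (v k) w m) :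
    Forbidden (Sk k) w (m + k) := by
  intro hmem
  apply h
  have hblock : (w.drop m).take k ∈ Sk k := by
    refine Or.inl ⟨by simp only [List.length_take, List.length_drop]; omega, ?_, ?_⟩
    · exact fun e => hu ⟨by rwa [length_u hk], by rwa [length_u hk]⟩
    · exact fun e => hv ⟨by rwa [length_v hk], by rwa [length_v hk]⟩
  rw [← List.take_append_drop k (w.drop m), List.drop_drop]
  exact append_mem_Pref_kstar hblock hmem

/-- Between two consecutive occurrences, a forbidden position propagates by multiples of `k`
into the window of length `k` that starts at the second occurrence. -/
theorem Consecutive.exists_forbidden {k : ℕ} (hk : 1 ≤ k) {w : Word} {s t : ℕ}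
    (hcons : Consecutive k w s t) (ht : t + k ≤ w.length) {m : ℕ} (hsm : s < m)
    (hmt : m < t + k) (h : Forbidden (Sk k) w m) :
    ∃ j n, j < k ∧ Forbidden (Sk k) w (t + j) ∧ m + n * k = t + j := by
  by_cases htm : t ≤ m
  · refine ⟨m - t, 0, by omega, ?_, by omega⟩
    rwa [Nat.add_sub_cancel' htm]
  · have hm : m < t := by omega
    obtain ⟨hu, hv⟩ := hcons.2 m hsm hm
    obtain ⟨j, n, hj, hf, e⟩ := hcons.exists_forbidden hk ht (m := m + k) (by omega) (by omega)
      (h.add_of_not_occursAt hk (by omega) hu hv)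
    exact ⟨j, n + 1, hj, hf, by rw [← e]; ring⟩
  termination_by t + k - m

theorem statement6 (k : ℕ) (hk : 4 ≤ k) (w p q : Word)
    (hp : p = u k ∨ p = v k) (hq : q = u k ∨ q = v k)
    (s t : ℕ) (hop : OccursAt p w s) (hoq : OccursAt q w t)
    (hcons : Consecutive k w s t) (hno : s + k ≤ t) :
    Focc k w p s ⊆ ((fun j => (j + (t - (s + k))) % k) '' Focc k w q t) ∪ {0} := by
  rintro i ⟨hi, hf⟩
  have hk1 : 1 ≤ k := by omega
  have hpl : p.length = k := by
    rcases hp with rfl | rfl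
    exacts [length_u hk1, length_v hk1]
  have hql : q.length = k := by
    rcases hq with rfl | rfl
    exacts [length_u hk1, length_v hk1]
  rw [hpl] at hi
  rcases Nat.eq_zero_or_pos i with rfl | hi0
  · exact Or.inr rfl
  have ht : t + k ≤ w.length := hql ▸ hoq.1
  obtain ⟨j, n, hj, hfj, e⟩ :=
    hcons.exists_forbidden hk1 ht (m := s + i) (by omega) (by omega) hf
  refine Or.inl ⟨j, ⟨by rwa [hql], hfj⟩, ?_⟩
  cases n with
  | zero => omega
  | succ n =>
    have hji : j + (t - (s + k)) = i + n * k := by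
      rw [Nat.succ_mul] at e
      omega
    simp only [hji, Nat.add_mul_mod_self_right, Nat.mod_eq_of_lt hi]

end Restivo
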